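/- Let (M,d) be a separable metric space and 1 < λ ≤ 3. If M has property π⁺(λ), then there exists a map f : M → c₀⁺ such that d(x,y) < ‖f(x) − f(y)‖ < λ·d(x,y) whenever x ≠ y. -/

import Mathlib

open Metric Set ZeroAtInfty

/-- The gap of a set `E ⊆ M × M`: `inf {d(x,y) : (x,y) ∈ E}`. -/
noncomputable def pairGap {M : Type*} [MetricSpace M] (E : Set (M × M)) : ℝ :=
  sInf ((fun p : M × M => dist p.1 p.2) '' E)

/-- The diameter of a set `E ⊆ M × M`: `sup {d(x,y) : (x,y) ∈ E}`. -/
noncomputable def pairDiam {M : Type*} [MetricSpace M] (E : Set (M × M)) : ℝ :=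
  sSup ((fun p : M × M => dist p.1 p.2) '' E)

/-- `π(E) = π₁(E) × π₂(E)`, the smallest rectangle containing `E`. -/
def pairRect {M : Type*} (E : Set (M × M)) : Set (M × M) :=
  (Prod.fst '' E) ×ˢ (Prod.snd '' E)

/-- `Es` is a finite partition of `E` into nonempty pairwise disjoint pieces. -/
def IsPartition {α : Type*} {N : ℕ} (Es : Fin N → Set α) (E : Set α) : Prop :=
  (∀ n, (Es n).Nonempty) ∧ (⋃ n, Es n) = E ∧
    ∀ i j : Fin N, i ≠ j → Disjoint (Es i) (Es j)

/-- Property `π(λ)`. -/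
def PropertyPi (M : Type*) [MetricSpace M] (lam : ℝ) : Prop :=
  ∀ (a₁ a₂ : M) (r₁ r₂ : ℝ) (E : Set (M × M)),
    E.Nonempty → E ⊆ (closedBall a₁ r₁) ×ˢ (closedBall a₂ r₂) →
    lam * (r₁ + r₂) < pairGap E →
    ∃ (N : ℕ) (Es : Fin N → Set (M × M)), IsPartition Es E ∧
      ∀ n, pairDiam (Es n) < lam * pairGap (pairRect (Es n))

/-- A good-λ-embedding into `c₀`. -/
def GoodEmbedding {M : Type*} [MetricSpace M] (lam : ℝ) (f : M → C₀(ℕ, ℝ)) : Prop :=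
  (∀ n : ℕ, ∃ K : ℝ, K < lam ∧ ∀ x y : M, |f x n - f y n| ≤ K * dist x y) ∧
    ∀ x y : M, dist x y ≤ ‖f x - f y‖

/-- A strict-λ-embedding into `c₀`. -/
def StrictEmbedding {M : Type*} [MetricSpace M] (lam : ℝ) (f : M → C₀(ℕ, ℝ)) : Prop :=
  ∀ x y : M, x ≠ y → dist x y < ‖f x - f y‖ ∧ ‖f x - f y‖ < lam * dist x y

/-- A λ-embedding into `c₀`. -/
def LambdaEmbedding {M : Type*} [MetricSpace M] (lam : ℝ) (f : M → C₀(ℕ, ℝ)) : Prop :=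
  ∀ x y : M, dist x y ≤ ‖f x - f y‖ ∧ ‖f x - f y‖ ≤ lam * dist x y

/-- The gap between two subsets of `M`: `δ(U,V) = inf {d(u,v) : u ∈ U, v ∈ V}`. -/
noncomputable def setGap {M : Type*} [MetricSpace M] (U V : Set M) : ℝ :=
  sInf ((fun p : M × M => dist p.1 p.2) '' (U ×ˢ V))

/-- Property π⁺(λ). -/
def PropertyPiPlus (M : Type*) [MetricSpace M] (lam : ℝ) : Prop :=
  (∀ (a₁ a₂ : M) (r₁ r₂ : ℝ), 0 < r₁ → 0 < r₂ → ∀ E : Set (M × M),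
    E.Nonempty → E ⊆ (closedBall a₁ r₁) ×ˢ (closedBall a₂ r₂) →
    lam * max r₁ r₂ < pairGap E →
    ∃ (N : ℕ) (Es : Fin N → Set (M × M)), IsPartition Es E ∧
      ∀ n, pairDiam (Es n) < lam * pairGap (pairRect (Es n))) ∧
  (∃ θ : ℝ, θ < lam ∧ ∃ φ : M → ℝ, (∀ x, 0 ≤ φ x) ∧
    ∀ x y : M, |φ x - φ y| ≤ dist x y ∧ dist x y ≤ θ * max (φ x) (φ y))

/-- The truncated bump of height `δ` around `U`, bounded by the positive part of `w` and
scaled by `K`. -/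
noncomputable def bump {M : Type*} [MetricSpace M] (K δ : ℝ) (U : Set M) (w : M → ℝ) (z : M) : ℝ :=
  K * max 0 (min (δ - infDist z U) (w z))

section Bump

variable {M : Type*} [MetricSpace M] {K δ : ℝ} {U : Set M} {w : M → ℝ}

lemma bump_nonneg (hK : 0 ≤ K) (z : M) : 0 ≤ bump K δ U w z :=
  mul_nonneg hK (le_max_left _ _)

lemma bump_le_mul_max (hK : 0 ≤ K) (z : M) : bump K δ U w z ≤ K * max 0 (w z) :=
  mul_le_mul_of_nonneg_left (max_le_max le_rfl (min_le_right _ _)) hK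

lemma bump_le_mul (hK : 0 ≤ K) (hδ : 0 ≤ δ) (z : M) : bump K δ U w z ≤ K * δ := by
  refine mul_le_mul_of_nonneg_left (max_le hδ ((min_le_left _ _).trans ?_)) hK
  linarith [infDist_nonneg (x := z) (s := U)]

lemma abs_bump_sub_le (hK : 0 ≤ K) (hw : ∀ x y, |w x - w y| ≤ dist x y) (x y : M) :
    |bump K δ U w x - bump K δ U w y| ≤ K * dist x y := by
  have hU : |(δ - infDist x U) - (δ - infDist y U)| ≤ dist x y := by
    have := (lipschitz_infDist_pt U).dist_le_mul y x
    rw [Real.dist_eq, dist_comm] at this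
    simpa using this
  unfold bump
  rw [← mul_sub, abs_mul, abs_of_nonneg hK]
  refine mul_le_mul_of_nonneg_left ?_ hK
  refine (abs_max_sub_max_le_max _ _ _ _).trans (max_le (by simp) ?_)
  exact (abs_min_sub_min_le_max _ _ _ _).trans (max_le hU (hw x y))

lemma bump_eq_zero (hU : U.Nonempty) {y : M} (hy : ∀ u ∈ U, δ ≤ dist y u) :
    bump K δ U w y = 0 := by
  have : δ ≤ infDist y U := (le_infDist hU).2 fun {u} hu => hy u hu
  unfold bump
  rw [max_eq_left ((min_le_left _ _).trans (by linarith)), mul_zero]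

lemma lt_bump {x : M} (hx : x ∈ U) (hK : 0 < K) {s : ℝ} (h₁ : s < K * δ) (h₂ : s < K * w x) :
    s < bump K δ U w x := by
  unfold bump
  rw [infDist_zero_of_mem hx, sub_zero]
  refine lt_of_lt_of_le ?_ (mul_le_mul_of_nonneg_left (le_max_right _ _) hK.le)
  rw [mul_min_of_nonneg _ _ hK.le]
  exact lt_min h₁ h₂

end Bump

lemma pairGap_le {M : Type*} [MetricSpace M] {E : Set (M × M)} {p : M × M} (hp : p ∈ E) :
    pairGap E ≤ dist p.1 p.2 :=
  csInf_le ⟨0, by rintro _ ⟨q, -, rfl⟩; exact dist_nonneg⟩ (mem_image_of_mem _ hp)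

lemma le_pairGap {M : Type*} [MetricSpace M] {E : Set (M × M)} (hE : E.Nonempty) {c : ℝ}
    (h : ∀ p ∈ E, c ≤ dist p.1 p.2) : c ≤ pairGap E :=
  le_csInf (hE.image _) (by rintro _ ⟨q, hq, rfl⟩; exact h q hq)

lemma le_pairDiam {M : Type*} [MetricSpace M] {E : Set (M × M)} {A : ℝ}
    (hA : ∀ p ∈ E, dist p.1 p.2 ≤ A) {p : M × M} (hp : p ∈ E) : dist p.1 p.2 ≤ pairDiam E :=
  le_csSup ⟨A, by rintro _ ⟨q, hq, rfl⟩; exact hA q hq⟩ (mem_image_of_mem _ hp)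

/-- A finite set of nonnegative functions with Lipschitz constants less than `lam` which
separates every pair of `E` by more than its distance, and is dominated by `lam * A` and by
`lam` times the positive part of `w`. -/
structure IsSeparating {M : Type*} [MetricSpace M] (lam A : ℝ) (w : M → ℝ) (E : Set (M × M))
    (G : Set (M → ℝ)) : Prop where
  finite : G.Finite
  nonneg : ∀ g ∈ G, ∀ z, 0 ≤ g z
  lipschitz : ∀ g ∈ G, ∃ K < lam, ∀ x y, |g x - g y| ≤ K * dist x y
  le_mul : ∀ g ∈ G, ∀ z, g z ≤ lam * A
  le_mul_max : ∀ g ∈ G, ∀ z, g z ≤ lam * max 0 (w z)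
  separates : ∀ p ∈ E, ∃ g ∈ G, dist p.1 p.2 < |g p.1 - g p.2|

lemma exists_isSeparating_of_pairDiam_lt {M : Type*} [MetricSpace M] {lam A σ : ℝ}
    (hlam : 0 < lam) (hσ : 0 < σ) {w : M → ℝ} (hw : ∀ x y, |w x - w y| ≤ dist x y)
    {P : Set (M × M)} (hP : P.Nonempty) (hA : ∀ p ∈ P, dist p.1 p.2 ≤ A)
    (hdiam : pairDiam P < lam * pairGap (pairRect P))
    (hPw : ∀ p ∈ P, dist p.1 p.2 / lam + σ ≤ max (w p.1) (w p.2)) :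
    ∃ G, IsSeparating lam A w P G := by
  set δ := pairGap (pairRect P)
  have hδ0 : 0 < δ := by
    obtain ⟨p, hp⟩ := hP
    have h0 : 0 < lam * δ := (dist_nonneg.trans (le_pairDiam hA hp)).trans_lt hdiam
    exact pos_of_mul_pos_right h0 hlam.le
  have hδ : ∀ u ∈ Prod.fst '' P, ∀ v ∈ Prod.snd '' P, δ ≤ dist u v := fun u hu v hv =>
    pairGap_le (p := (u, v)) ⟨hu, hv⟩
  have hδA : δ ≤ A := by
    obtain ⟨p, hp⟩ := hP
    exact (hδ _ (mem_image_of_mem _ hp) _ (mem_image_of_mem _ hp)).trans (hA p hp)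
  obtain ⟨K, hKlam, hK0, hKδ, hKσ⟩ : ∃ K < lam, 0 < K ∧ pairDiam P < K * δ ∧
      A * (1 - K / lam) < K * σ := by
    have e₁ : ∀ᶠ K in nhdsWithin lam (Iio lam), K < lam := self_mem_nhdsWithin
    have e₂ : ∀ᶠ K in nhds lam, 0 < K := lt_mem_nhds hlam
    have e₃ : ∀ᶠ K in nhds lam, pairDiam P < K * δ :=
      (continuous_id.mul continuous_const).continuousAt.eventually_const_lt hdiam
    have e₄ : ∀ᶠ K in nhds lam, A * (1 - K / lam) < K * σ := by
      refine ContinuousAt.eventually_lt (by fun_prop) (by fun_prop) ?_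
      rw [div_self hlam.ne']
      simpa using mul_pos hlam hσ
    obtain ⟨K, h₁, h₂, h₃, h₄⟩ := (e₁.and ((e₂.and (e₃.and e₄)).filter_mono
      nhdsWithin_le_nhds)).exists
    exact ⟨K, h₁, h₂, h₃, h₄⟩
  have key : ∀ s c : ℝ, s ≤ A → s / lam + σ ≤ c → s < K * c := by
    intro s c hs hc
    have h₁ : K * (s / lam + σ) ≤ K * c := mul_le_mul_of_nonneg_left hc hK0.le
    have h₂ : s * (1 - K / lam) ≤ A * (1 - K / lam) := by
      refine mul_le_mul_of_nonneg_right hs ?_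
      rw [sub_nonneg, div_le_one hlam]
      exact hKlam.le
    have h₃ : K * (s / lam + σ) = K * σ + s - s * (1 - K / lam) := by ring
    linarith
  have hG : ∀ U : Set M, (∀ z, 0 ≤ bump K δ U w z) ∧
      (∃ K' < lam, ∀ x y, |bump K δ U w x - bump K δ U w y| ≤ K' * dist x y) ∧
      (∀ z, bump K δ U w z ≤ lam * A) ∧ ∀ z, bump K δ U w z ≤ lam * max 0 (w z) := fun U =>
    ⟨bump_nonneg hK0.le, ⟨K, hKlam, abs_bump_sub_le hK0.le hw⟩,
      fun z => (bump_le_mul hK0.le hδ0.le z).trans (mul_le_mul hKlam.le hδA hδ0.le hlam.le),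
      fun z => (bump_le_mul_max hK0.le z).trans
        (mul_le_mul_of_nonneg_right hKlam.le (le_max_left _ _))⟩
  refine ⟨{bump K δ (Prod.fst '' P) w, bump K δ (Prod.snd '' P) w}, by simp, ?_, ?_, ?_, ?_, ?_⟩
  · rintro g (rfl | rfl)
    exacts [(hG _).1, (hG _).1]
  · rintro g (rfl | rfl)
    exacts [(hG _).2.1, (hG _).2.1]
  · rintro g (rfl | rfl)
    exacts [(hG _).2.2.1, (hG _).2.2.1]
  · rintro g (rfl | rfl)
    exacts [(hG _).2.2.2, (hG _).2.2.2]
  · intro p hp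
    have h1 : p.1 ∈ Prod.fst '' P := mem_image_of_mem _ hp
    have h2 : p.2 ∈ Prod.snd '' P := mem_image_of_mem _ hp
    have hd : dist p.1 p.2 < K * δ := (le_pairDiam hA hp).trans_lt hKδ
    rcases le_max_iff.1 (hPw p hp) with h | h
    · refine ⟨_, mem_insert _ _, lt_of_lt_of_le ?_ (le_abs_self _)⟩
      have h0 : bump K δ (Prod.fst '' P) w p.2 = 0 :=
        bump_eq_zero (hP.image _) fun u hu => (hδ u hu _ h2).trans_eq (dist_comm _ _)
      rw [h0, sub_zero]
      exact lt_bump h1 hK0 hd (key _ _ (hA p hp) h)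
    · refine ⟨_, mem_insert_of_mem _ rfl, ?_⟩
      rw [abs_sub_comm]
      refine lt_of_lt_of_le ?_ (le_abs_self _)
      have h0 : bump K δ (Prod.snd '' P) w p.1 = 0 := bump_eq_zero (hP.image _) (hδ _ h1)
      rw [h0, sub_zero]
      exact lt_bump h2 hK0 hd (key _ _ (hA p hp) h)

/-- A set of pairs of bounded length, each of which is close to a pair of points of a fixed finite
set, is covered by finitely many pieces as in property `π⁺`. -/
lemma PropertyPiPlus.exists_finite_cover {M : Type*} [MetricSpace M] {lam : ℝ}
    (h : PropertyPiPlus M lam) (hlam : 0 < lam) {A τ : ℝ} (hτ : 0 < τ) {F : Set M}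
    (hF : F.Finite) {E : Set (M × M)} (hA : ∀ p ∈ E, dist p.1 p.2 ≤ A)
    (hE₁ : ∀ p ∈ E, ∃ a ∈ F, dist p.1 a + τ ≤ dist p.1 p.2 / lam)
    (hE₂ : ∀ p ∈ E, ∃ b ∈ F, dist p.2 b + τ ≤ dist p.1 p.2 / lam) :
    ∃ S : Set (Set (M × M)), S.Finite ∧ E ⊆ ⋃₀ S ∧
      ∀ P ∈ S, P.Nonempty ∧ P ⊆ E ∧ pairDiam P < lam * pairGap (pairRect P) := by
  set η := lam * τ / 2 with hη
  have hη0 : 0 < η := by positivity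
  let Q : (M × M) × ℕ → Set (M × M) := fun i => {p ∈ E | dist p.1 i.1.1 + τ ≤ dist p.1 p.2 / lam ∧
    dist p.2 i.1.2 + τ ≤ dist p.1 p.2 / lam ∧ η * i.2 ≤ dist p.1 p.2 ∧
      dist p.1 p.2 ≤ η * (i.2 + 1)}
  have hQ : ∀ i, ∃ S : Set (Set (M × M)), S.Finite ∧ Q i ⊆ ⋃₀ S ∧
      ∀ P ∈ S, P.Nonempty ∧ P ⊆ Q i ∧ pairDiam P < lam * pairGap (pairRect P) := by
    rintro ⟨⟨a, b⟩, j⟩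
    rcases (Q ((a, b), j)).eq_empty_or_nonempty with h0 | hne
    · exact ⟨∅, finite_empty, by simp [h0], by simp⟩
    set r := η * j / lam - τ / 4 with hr
    have hηlam : η / lam = τ / 2 := by rw [hη]; field_simp
    have hbound : ∀ s d : ℝ, d + τ ≤ s / lam → s ≤ η * (j + 1) → d + τ / 4 ≤ r := by
      intro s d h₁ h₂
      have h₃ : s / lam ≤ η * (j + 1) / lam := by gcongr
      have h₄ : η * (j + 1) / lam = η * j / lam + η / lam := by ring
      linarith
    have hr0 : 0 < r := by
      obtain ⟨p, hp⟩ := hne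
      have := hbound _ _ hp.2.1 hp.2.2.2.2
      have := dist_nonneg (x := p.1) (y := a)
      linarith
    have hgap : lam * max r r < pairGap (Q ((a, b), j)) := by
      refine lt_of_lt_of_le ?_ (le_pairGap hne fun p hp => hp.2.2.2.1)
      have : lam * r = η * j - lam * (τ / 4) := by rw [hr]; field_simp
      have : 0 < lam * (τ / 4) := by positivity
      simp only [max_self]
      linarith
    have hsub : Q ((a, b), j) ⊆ closedBall a r ×ˢ closedBall b r := by
      intro p hp
      have h₁ := hbound _ _ hp.2.1 hp.2.2.2.2
      have h₂ := hbound _ _ hp.2.2.1 hp.2.2.2.2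
      exact ⟨mem_closedBall.2 (by linarith), mem_closedBall.2 (by linarith)⟩
    obtain ⟨N, Es, ⟨hne', hU, -⟩, hEs⟩ := h.1 a b r r hr0 hr0 _ hne hsub hgap
    refine ⟨range Es, finite_range _, by rw [sUnion_range, hU], ?_⟩
    rintro _ ⟨n, rfl⟩
    exact ⟨hne' n, hU ▸ subset_iUnion Es n, hEs n⟩
  choose S hSfin hScov hS using hQ
  refine ⟨⋃ i ∈ (F ×ˢ F) ×ˢ Iic ⌊A / η⌋₊, S i,
    ((hF.prod hF).prod (finite_Iic _)).biUnion fun i _ => hSfin i, ?_, ?_⟩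
  · intro p hp
    obtain ⟨a, ha, hpa⟩ := hE₁ p hp
    obtain ⟨b, hb, hpb⟩ := hE₂ p hp
    set j := ⌊dist p.1 p.2 / η⌋₊
    have h₁ : (j : ℝ) ≤ dist p.1 p.2 / η := Nat.floor_le (by positivity)
    have h₂ : dist p.1 p.2 / η < j + 1 := Nat.lt_floor_add_one _
    rw [le_div_iff₀ hη0] at h₁
    rw [div_lt_iff₀ hη0] at h₂
    have hpQ : p ∈ Q ((a, b), j) := ⟨hp, hpa, hpb, by linarith, by linarith⟩
    obtain ⟨P, hP, hpP⟩ := hScov _ hpQ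
    refine ⟨P, mem_biUnion (x := ((a, b), j)) ⟨⟨ha, hb⟩, ?_⟩ hP, hpP⟩
    exact Nat.floor_le_floor (div_le_div_of_nonneg_right (hA p hp) hη0.le)
  · intro P hP
    obtain ⟨i, -, hPi⟩ := mem_iUnion₂.1 hP
    exact ⟨(hS i P hPi).1, (hS i P hPi).2.1.trans (sep_subset _ _), (hS i P hPi).2.2⟩

lemma PropertyPiPlus.exists_isSeparating {M : Type*} [MetricSpace M] {lam : ℝ}
    (h : PropertyPiPlus M lam) (hlam : 0 < lam) {A τ σ : ℝ} (hτ : 0 < τ) (hσ : 0 < σ)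
    {w : M → ℝ} (hw : ∀ x y, |w x - w y| ≤ dist x y) {F : Set M}
    (hF : F.Finite) {E : Set (M × M)} (hA : ∀ p ∈ E, dist p.1 p.2 ≤ A)
    (hE₁ : ∀ p ∈ E, ∃ a ∈ F, dist p.1 a + τ ≤ dist p.1 p.2 / lam)
    (hE₂ : ∀ p ∈ E, ∃ b ∈ F, dist p.2 b + τ ≤ dist p.1 p.2 / lam)
    (hEw : ∀ p ∈ E, dist p.1 p.2 / lam + σ ≤ max (w p.1) (w p.2)) :
    ∃ G, IsSeparating lam A w E G := by
  obtain ⟨S, hSfin, hScov, hS⟩ := h.exists_finite_cover hlam hτ hF hA hE₁ hE₂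
  have : ∀ P : S, ∃ G, IsSeparating lam A w P.1 G := fun P =>
    have hP := hS P.1 P.2
    exists_isSeparating_of_pairDiam_lt hlam hσ hw hP.1 (fun p hp => hA p (hP.2.1 hp)) hP.2.2
      fun p hp => hEw p (hP.2.1 hp)
  choose G hG using this
  have := hSfin.to_subtype
  refine ⟨⋃ P, G P, finite_iUnion fun P => (hG P).finite, ?_, ?_, ?_, ?_, ?_⟩
  · rintro g hg
    obtain ⟨P, hg⟩ := mem_iUnion.1 hg
    exact (hG P).nonneg g hg
  · rintro g hg
    obtain ⟨P, hg⟩ := mem_iUnion.1 hg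
    exact (hG P).lipschitz g hg
  · rintro g hg
    obtain ⟨P, hg⟩ := mem_iUnion.1 hg
    exact (hG P).le_mul g hg
  · rintro g hg
    obtain ⟨P, hg⟩ := mem_iUnion.1 hg
    exact (hG P).le_mul_max g hg
  · intro p hp
    obtain ⟨P, hP, hpP⟩ := hScov hp
    obtain ⟨g, hg, hlt⟩ := (hG ⟨P, hP⟩).separates p hpP
    exact ⟨g, mem_iUnion.2 ⟨_, hg⟩, hlt⟩

/-- A countable set of nonnegative functions with Lipschitz constants less than `lam`, vanishing
at infinity pointwise and strictly expanding all distances, gives an embedding into `c₀⁺`. -/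
lemma exists_embedding_of_countable {M : Type*} [MetricSpace M] {lam : ℝ} (hlam : 0 < lam)
    {G : Set (M → ℝ)} (hG : G.Countable) (hnonneg : ∀ g ∈ G, ∀ z, 0 ≤ g z)
    (hlip : ∀ g ∈ G, ∃ K < lam, ∀ x y, |g x - g y| ≤ K * dist x y)
    (hfin : ∀ z, ∀ ε > 0, {g ∈ G | ε ≤ g z}.Finite)
    (hsep : ∀ x y, x ≠ y → ∃ g ∈ G, dist x y < |g x - g y|) :
    ∃ f : M → C₀(ℕ, ℝ), (∀ (x : M) (n : ℕ), 0 ≤ f x n) ∧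
      ∀ x y : M, x ≠ y → dist x y < ‖f x - f y‖ ∧ ‖f x - f y‖ < lam * dist x y := by
  have : Countable G := hG
  obtain ⟨e, he⟩ := Countable.exists_injective_nat G
  let c : M → ℕ → ℝ := fun x => Function.extend e (fun g => g.1 x) 0
  have hc : ∀ x (g : G), c x (e g) = g.1 x := fun x g => he.extend_apply _ _ g
  have hc0 : ∀ x n, (¬∃ g, e g = n) → c x n = 0 := fun x n hn =>
    Function.extend_apply' _ _ n hn
  have hcnonneg : ∀ x n, 0 ≤ c x n := by
    intro x n
    by_cases hn : ∃ g, e g = n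
    · obtain ⟨g, rfl⟩ := hn
      rw [hc]
      exact hnonneg g.1 g.2 x
    · rw [hc0 x n hn]
  have hcfin : ∀ x, ∀ ε > 0, {n | ε ≤ c x n}.Finite := by
    intro x ε hε
    have h₁ : {g : G | ε ≤ g.1 x}.Finite := by
      refine Finite.of_finite_image ?_ Subtype.val_injective.injOn
      refine (hfin x ε hε).subset ?_
      rintro _ ⟨g, hg, rfl⟩
      exact ⟨g.2, hg⟩
    refine (h₁.image e).subset fun n (hn : ε ≤ c x n) => ?_
    by_cases hn' : ∃ g, e g = n
    · obtain ⟨g, rfl⟩ := hn'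
      exact ⟨g, by rwa [hc] at hn, rfl⟩
    · rw [hc0 x n hn'] at hn
      linarith
  have hlim : ∀ x, Filter.Tendsto (c x) (Filter.cocompact ℕ) (nhds 0) := by
    intro x
    rw [Filter.cocompact_eq_cofinite, Metric.tendsto_nhds]
    intro ε hε
    refine (hcfin x ε hε).subset fun n hn => ?_
    simpa [abs_of_nonneg (hcnonneg x n)] using hn
  let f : M → C₀(ℕ, ℝ) := fun x => ⟨⟨c x, continuous_of_discreteTopology⟩, hlim x⟩
  have hle : ∀ (u : C₀(ℕ, ℝ)) (n : ℕ), |u n| ≤ ‖u‖ := fun u n =>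
    u.toBCF.norm_coe_le_norm n
  refine ⟨f, hcnonneg, fun x y hxy => ⟨?_, ?_⟩⟩
  · obtain ⟨g, hg, hlt⟩ := hsep x y hxy
    refine hlt.trans_le ?_
    have := hle (f x - f y) (e ⟨g, hg⟩)
    change |c x _ - c y _| ≤ _ at this
    rwa [hc, hc] at this
  · have hd : 0 < lam * dist x y := mul_pos hlam (dist_pos.2 hxy)
    have hlt : ∀ n, |c x n - c y n| < lam * dist x y := by
      intro n
      by_cases hn : ∃ g, e g = n
      · obtain ⟨g, rfl⟩ := hn
        obtain ⟨K, hK, hg⟩ := hlip g.1 g.2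
        rw [hc, hc]
        exact (hg x y).trans_lt (mul_lt_mul_of_pos_right hK (dist_pos.2 hxy))
      · rw [hc0 x n hn, hc0 y n hn]
        simpa using hd
    set s := {n | lam * dist x y / 2 ≤ |c x n - c y n|}
    have hsfin : s.Finite := by
      refine ((hcfin x _ (half_pos hd)).union (hcfin y _ (half_pos hd))).subset fun n hn => ?_
      have h₁ := hcnonneg x n
      have h₂ := hcnonneg y n
      rcases le_abs.1 (show _ ≤ |c x n - c y n| from hn) with h | h
      · exact Or.inl (show lam * dist x y / 2 ≤ c x n by linarith)
      · exact Or.inr (show lam * dist x y / 2 ≤ c y n by linarith)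
    obtain ⟨C, hC, hCle⟩ : ∃ C < lam * dist x y, ∀ n ∈ s, |c x n - c y n| ≤ C := by
      rcases s.eq_empty_or_nonempty with h0 | hne
      · exact ⟨0, hd, by simp [h0]⟩
      · obtain ⟨n, -, hn⟩ := exists_max_image s (fun n => |c x n - c y n|) hsfin hne
        exact ⟨_, hlt n, hn⟩
    have hnorm : ‖f x - f y‖ ≤ max C (lam * dist x y / 2) := by
      refine (BoundedContinuousFunction.norm_le (f := (f x - f y).toBCF)
        ((half_pos hd).le.trans (le_max_right _ _))).2 fun n => ?_
      change |c x n - c y n| ≤ _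
      by_cases hn : n ∈ s
      · exact (hCle n hn).trans (le_max_left _ _)
      · exact (not_le.1 hn).le.trans (le_max_right _ _)
    exact hnorm.trans_lt (max_lt hC (half_lt_self hd))

/-- The distance to the first `k` terms of `a`, with the constant `1` for `k = 0`. -/
noncomputable def distInitial {M : Type*} [MetricSpace M] (a : ℕ → M) : ℕ → M → ℝ
  | 0, _ => 1
  | k + 1, z => infDist z (a '' Iic k)

section DistInitial

variable {M : Type*} [MetricSpace M] (a : ℕ → M)

lemma distInitial_nonneg (k : ℕ) (z : M) : 0 ≤ distInitial a k z := by
  cases k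
  exacts [zero_le_one, infDist_nonneg]

lemma abs_distInitial_sub_le (k : ℕ) (x y : M) :
    |distInitial a k x - distInitial a k y| ≤ dist x y := by
  cases k with
  | zero => simp [distInitial]
  | succ k =>
    have := (lipschitz_infDist_pt (a '' Iic k)).dist_le_mul x y
    simpa [Real.dist_eq, distInitial] using this

lemma exists_dist_eq_distInitial_succ (k : ℕ) (z : M) :
    ∃ b ∈ a '' Iic k, dist z b = distInitial a (k + 1) z := by
  obtain ⟨b, hb, h⟩ := ((finite_Iic k).image a).isCompact.exists_infDist_eq_dist
    (nonempty_Iic.image a) z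
  exact ⟨b, hb, h.symm⟩

lemma exists_forall_distInitial_lt (ha : DenseRange a) (z : M) {ε : ℝ} (hε : 0 < ε) :
    ∃ k₀, ∀ k ≥ k₀, distInitial a k z < ε := by
  obtain ⟨i, hi⟩ := ha.exists_dist_lt z hε
  refine ⟨i + 1, fun k hk => ?_⟩
  obtain ⟨j, rfl⟩ : ∃ j, k = j + 1 := ⟨k - 1, by omega⟩
  exact (infDist_le_dist_of_mem (mem_image_of_mem a (by simpa using hk))).trans_lt hi

end DistInitial

/-- The pairs which are not seen at resolution `1 / (k + 1)` by the first `k` terms of `a`. -/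
def unresolved {M : Type*} [MetricSpace M] (lam : ℝ) (a : ℕ → M) (k : ℕ) : Set (M × M) :=
  {p | dist p.1 p.2 / lam ≤ max (distInitial a k p.1) (distInitial a k p.2) + 1 / ((k : ℝ) + 1)}

/-- The pairs of length about `2 ^ m` which become resolved by the `k`-th term of `a`; for `k ≤ m`
it is not required that they are unresolved before. -/
def resolvedAt {M : Type*} [MetricSpace M] (lam : ℝ) (a : ℕ → M) (k : ℕ) (m : ℤ) : Set (M × M) :=
  {p | dist p.1 p.2 ∈ Ico ((2 : ℝ) ^ m) (2 ^ (m + 1)) ∧ p ∉ unresolved lam a (k + 1) ∧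
    (m < k → p ∈ unresolved lam a k)}

lemma exists_notMem_unresolved {M : Type*} [MetricSpace M] {lam : ℝ} (hlam : 0 < lam) {a : ℕ → M}
    (ha : DenseRange a) {p : M × M} (hp : p.1 ≠ p.2) : ∃ k, p ∉ unresolved lam a (k + 1) := by
  have hd : 0 < dist p.1 p.2 / lam / 2 := half_pos (div_pos (dist_pos.2 hp) hlam)
  obtain ⟨k₁, h₁⟩ := exists_forall_distInitial_lt a ha p.1 hd
  obtain ⟨k₂, h₂⟩ := exists_forall_distInitial_lt a ha p.2 hd
  obtain ⟨k₃, h₃⟩ := exists_nat_one_div_lt hd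
  refine ⟨k₁ + k₂ + k₃, ?_⟩
  simp only [unresolved, mem_ofPred_eq, not_le]
  have h₄ : 1 / (((k₁ + k₂ + k₃ + 1 : ℕ) : ℝ) + 1) ≤ 1 / ((k₃ : ℝ) + 1) := by
    apply one_div_le_one_div_of_le (by positivity)
    norm_cast
    omega
  have h₅ := max_lt (h₁ (k₁ + k₂ + k₃ + 1) (by omega)) (h₂ (k₁ + k₂ + k₃ + 1) (by omega))
  linarith

lemma exists_mem_resolvedAt {M : Type*} [MetricSpace M] {lam : ℝ} (hlam : 1 < lam) {a : ℕ → M}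
    (ha : DenseRange a) {p : M × M} (hp : p.1 ≠ p.2) : ∃ k m, p ∈ resolvedAt lam a k m := by
  classical
  have hlam0 : 0 < lam := by linarith
  have hex := exists_notMem_unresolved hlam0 ha hp
  obtain ⟨m, hm⟩ := exists_mem_Ico_zpow (dist_pos.2 hp) one_lt_two
  refine ⟨Nat.find hex, m, hm, Nat.find_spec hex, fun hlt => ?_⟩
  generalize hk : Nat.find hex = k at hlt
  cases k with
  | zero =>
    have h₁ : dist p.1 p.2 < 1 := by
      refine hm.2.trans_le (zpow_le_one_of_nonpos₀ one_le_two ?_)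
      have : m < 0 := by exact_mod_cast hlt
      omega
    have h₂ : dist p.1 p.2 / lam ≤ dist p.1 p.2 := div_le_self dist_nonneg hlam.le
    have : dist p.1 p.2 / lam ≤ max 1 1 + 1 / (((0 : ℕ) : ℝ) + 1) := by
      norm_num
      linarith
    exact this
  | succ k => exact not_not.1 (Nat.find_min hex (m := k) (by omega))

/-- The function dominating the functions that separate the pairs in `resolvedAt lam a k m`. -/
noncomputable def dominant {M : Type*} [MetricSpace M] (a : ℕ → M) (φ : M → ℝ) (c : ℝ) (k : ℕ)
    (m : ℤ) (z : M) : ℝ :=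
  if m < k then distInitial a k z + 2 * (1 / ((k : ℝ) + 1)) else φ z - c * 2 ^ m

lemma PropertyPiPlus.exists_isSeparating_resolvedAt {M : Type*} [MetricSpace M] {lam : ℝ}
    (h : PropertyPiPlus M lam) (hlam : 0 < lam) (a : ℕ → M) {φ : M → ℝ} {c : ℝ} (hc : 0 < c)
    (hφ : ∀ x y, |φ x - φ y| ≤ dist x y)
    (hφc : ∀ x y, dist x y * (1 / lam + 2 * c) ≤ max (φ x) (φ y)) (k : ℕ) (m : ℤ) :
    ∃ G, IsSeparating lam (2 ^ (m + 1)) (dominant a φ c k m) (resolvedAt lam a k m) G := by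
  have hm : (0 : ℝ) < 2 ^ m := by positivity
  have hk : (0 : ℝ) < 1 / ((k : ℝ) + 1) := by positivity
  refine h.exists_isSeparating hlam (τ := 1 / (((k + 1 : ℕ) : ℝ) + 1))
    (σ := min (1 / ((k : ℝ) + 1)) (c * 2 ^ m)) (by positivity) (lt_min hk (by positivity)) ?_
    ((finite_Iic k).image a) (fun p hp => hp.1.2.le) ?_ ?_ ?_
  · intro x y
    unfold dominant
    split_ifs
    · simpa using abs_distInitial_sub_le a k x y
    · simpa using hφ x y
  · intro p hp
    obtain ⟨b, hb, hpb⟩ := exists_dist_eq_distInitial_succ a k p.1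
    refine ⟨b, hb, hpb ▸ le_trans ?_ (not_le.1 hp.2.1).le⟩
    gcongr
    exact le_max_left _ _
  · intro p hp
    obtain ⟨b, hb, hpb⟩ := exists_dist_eq_distInitial_succ a k p.2
    refine ⟨b, hb, hpb ▸ le_trans ?_ (not_le.1 hp.2.1).le⟩
    gcongr
    exact le_max_right _ _
  · intro p hp
    unfold dominant
    split_ifs with hmk
    · have h₁ := hp.2.2 hmk
      simp only [unresolved, mem_ofPred_eq] at h₁
      rw [max_add_add_right]
      linarith [min_le_left (1 / ((k : ℝ) + 1)) (c * 2 ^ m)]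
    · have h₁ := hφc p.1 p.2
      have h₂ : c * 2 ^ m ≤ c * dist p.1 p.2 := mul_le_mul_of_nonneg_left hp.1.1 hc.le
      have h₃ : dist p.1 p.2 * (1 / lam + 2 * c) = dist p.1 p.2 / lam + 2 * (c * dist p.1 p.2) := by
        ring
      rw [max_sub_sub_right]
      linarith [min_le_right (1 / ((k : ℝ) + 1)) (c * 2 ^ m)]

lemma finite_setOf_le_dominant {M : Type*} [MetricSpace M] {lam : ℝ} (hlam : 0 < lam) {a : ℕ → M}
    (ha : DenseRange a) (φ : M → ℝ) {c : ℝ} (hc : 0 < c) (z : M) {ε : ℝ} (hε : 0 < ε) :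
    {i : ℕ × ℤ | ε ≤ lam * 2 ^ (i.2 + 1) ∧ ε ≤ lam * max 0 (dominant a φ c i.1 i.2 z)}.Finite := by
  have hε' : 0 < ε / lam / 3 := by positivity
  obtain ⟨k₁, hk₁⟩ := exists_forall_distInitial_lt a ha z hε'
  obtain ⟨k₂, hk₂⟩ := exists_nat_one_div_lt hε'
  obtain ⟨m₁, hm₁⟩ := exists_nat_gt (φ z / c)
  obtain ⟨m₀, hm₀⟩ := exists_mem_Ico_zpow (div_pos hε hlam) (one_lt_two (α := ℝ))
  refine ((finite_Iic (k₁ + k₂ + m₁)).prod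
    (finite_Icc (m₀ - 1) ((k₁ + k₂ + m₁ : ℕ) : ℤ))).subset ?_
  rintro ⟨k, m⟩ ⟨h₁, h₂⟩
  simp only at h₁ h₂
  rw [mul_comm, ← div_le_iff₀ hlam] at h₁ h₂
  have hlow : m₀ ≤ m + 1 := (zpow_le_zpow_iff_right₀ one_lt_two).1 (hm₀.1.trans h₁)
  have h₃ : ε / lam ≤ dominant a φ c k m z :=
    (le_max_iff.1 h₂).resolve_left (not_le.2 (div_pos hε hlam))
  unfold dominant at h₃
  suffices k ≤ k₁ + k₂ + m₁ ∧ m ≤ ((k₁ + k₂ + m₁ : ℕ) : ℤ) from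
    ⟨this.1, by change m₀ - 1 ≤ m; omega, this.2⟩
  split_ifs at h₃ with hmk
  · have hk : k ≤ k₁ + k₂ := by
      by_contra! hlt
      have h₄ := hk₁ k (by omega)
      have h₅ : 1 / ((k : ℝ) + 1) ≤ 1 / ((k₂ : ℝ) + 1) := by
        apply one_div_le_one_div_of_le (by positivity)
        norm_cast
        omega
      linarith
    omega
  · have hm : m < m₁ := by
      by_contra! hle
      have h₄ : (m₁ : ℝ) ≤ 2 ^ m := by
        refine le_trans ?_ (zpow_le_zpow_right₀ one_le_two hle)
        rw [zpow_natCast]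
        exact_mod_cast Nat.lt_two_pow_self.le
      have h₅ : φ z < c * 2 ^ m := by
        rw [mul_comm, ← div_lt_iff₀ hc]
        exact hm₁.trans_le h₄
      linarith [div_pos hε hlam]
    omega

/-- Theorem 6.9: if a separable metric space `M` has property π⁺(λ) with `1 < λ ≤ 3`, then
there is a map `f : M → c₀⁺` with `d(x,y) < ‖f(x) - f(y)‖ < λ·d(x,y)` for `x ≠ y`. -/
theorem stmt18 {M : Type*} [MetricSpace M] [TopologicalSpace.SeparableSpace M]
    (lam : ℝ) (hlam₁ : 1 < lam) (hlam₂ : lam ≤ 3) (h : PropertyPiPlus M lam) :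
    ∃ f : M → C₀(ℕ, ℝ), (∀ (x : M) (n : ℕ), 0 ≤ f x n) ∧
      ∀ x y : M, x ≠ y → dist x y < ‖f x - f y‖ ∧ ‖f x - f y‖ < lam * dist x y := by
  rcases isEmpty_or_nonempty M with hM | hM
  · exact ⟨fun x => isEmptyElim x, fun x => isEmptyElim x, fun x => isEmptyElim x⟩
  have hlam0 : 0 < lam := by linarith
  obtain ⟨θ, hθ, φ, hφ0, hφ⟩ := h.2
  obtain ⟨c, hc, hφc⟩ : ∃ c > 0, ∀ x y, dist x y * (1 / lam + 2 * c) ≤ max (φ x) (φ y) := by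
    have hθ1 : 0 < max θ 1 := lt_max_of_lt_right one_pos
    refine ⟨(1 / max θ 1 - 1 / lam) / 2,
      half_pos (sub_pos.2 (one_div_lt_one_div_of_lt hθ1 (max_lt hθ hlam₁))), fun x y => ?_⟩
    have h₁ : dist x y ≤ max θ 1 * max (φ x) (φ y) := (hφ x y).2.trans
      (mul_le_mul_of_nonneg_right (le_max_left _ _) (le_max_of_le_left (hφ0 x)))
    rw [mul_div_cancel₀ _ two_ne_zero, add_sub_cancel, mul_one_div, div_le_iff₀ hθ1]
    linarith
  let a := TopologicalSpace.denseSeq M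
  have ha : DenseRange a := TopologicalSpace.denseRange_denseSeq M
  have hex := h.exists_isSeparating_resolvedAt hlam0 a hc (fun x y => (hφ x y).1) hφc
  choose G hG using hex
  refine exists_embedding_of_countable hlam0 (G := ⋃ i : ℕ × ℤ, G i.1 i.2)
    (countable_iUnion fun i => (hG i.1 i.2).finite.countable) ?_ ?_ ?_ ?_
  · intro g hg
    obtain ⟨i, hi⟩ := mem_iUnion.1 hg
    exact (hG i.1 i.2).nonneg g hi
  · intro g hg
    obtain ⟨i, hi⟩ := mem_iUnion.1 hg
    exact (hG i.1 i.2).lipschitz g hi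
  · intro z ε hε
    refine ((finite_setOf_le_dominant hlam0 ha φ hc z hε).biUnion
      fun i _ => (hG i.1 i.2).finite).subset ?_
    rintro g ⟨hg, hgz⟩
    obtain ⟨i, hi⟩ := mem_iUnion.1 hg
    exact mem_biUnion (x := i) ⟨hgz.trans ((hG i.1 i.2).le_mul g hi z),
      hgz.trans ((hG i.1 i.2).le_mul_max g hi z)⟩ hi
  · intro x y hxy
    obtain ⟨k, m, hkm⟩ := exists_mem_resolvedAt hlam₁ ha (p := (x, y)) hxy
    obtain ⟨g, hg, hlt⟩ := (hG k m).separates _ hkm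
    exact ⟨g, mem_iUnion.2 ⟨(k, m), hg⟩, hlt⟩
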